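/- Let n ∈ ℕ and c ∈ ℝ². The space (𝒫ⁿ)² of vector-valued polynomial maps ℝ² → ℝ² of total degree at most n admits the two internal direct sum decompositions (𝒫ⁿ)² = {∇p : p ∈ 𝒫^{n+1}} ⊕ {x ↦ p(x)(x − c)^⊥ : p ∈ 𝒫^{n−1}} and (𝒫ⁿ)² = {(∇z)^⊥ : z ∈ 𝒫^{n+1}} ⊕ {x ↦ p(x)(x − c) : p ∈ 𝒫^{n−1}}. -/

import Mathlib

open Matrix MeasureTheory
open scoped InnerProductSpace

noncomputable section

/-- Scalar polynomial functions `ℝ^d → ℝ` of total degree at most `n`. -/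
def polySpace (d n : ℕ) : Submodule ℝ ((Fin d → ℝ) → ℝ) where
  carrier := {f | ∃ p : MvPolynomial (Fin d) ℝ,
    p.totalDegree ≤ n ∧ ∀ x, f x = MvPolynomial.eval x p}
  add_mem' := by
    rintro f g ⟨p, hp, hfp⟩ ⟨q, hq, hgq⟩
    exact ⟨p + q, le_trans (MvPolynomial.totalDegree_add p q) (max_le hp hq),
      fun x => by simp [hfp x, hgq x]⟩
  zero_mem' := ⟨0, by simp, fun x => by simp⟩
  smul_mem' := by
    rintro a f ⟨p, hp, hfp⟩
    exact ⟨a • p, le_trans (MvPolynomial.totalDegree_smul_le a p) hp,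
      fun x => by simp [hfp x, MvPolynomial.smul_eval]⟩

/-- Scalar polynomial functions of total degree at most `n` for `n : ℤ`,
with the convention that the space is `{0}` for negative `n`. -/
def polySpaceZ (d : ℕ) (n : ℤ) : Submodule ℝ ((Fin d → ℝ) → ℝ) :=
  if 0 ≤ n then polySpace d n.toNat else ⊥

/-- Vector-valued polynomial maps `ℝ^d → ℝ^d`, all of whose components are
polynomial functions of total degree at most `n` (`n : ℤ`). -/
def vecPolySpaceZ (d : ℕ) (n : ℤ) : Submodule ℝ ((Fin d → ℝ) → (Fin d → ℝ)) where
  carrier := {f | ∀ i, (fun x => f x i) ∈ polySpaceZ d n}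
  add_mem' := fun hf hg i => (polySpaceZ d n).add_mem (hf i) (hg i)
  zero_mem' := fun i => (polySpaceZ d n).zero_mem
  smul_mem' := fun a {f} hf i => (polySpaceZ d n).smul_mem a (hf i)

/-- The gradient `∇v = (∂₁v, …, ∂_d v)` of a scalar field. -/
def grad {d : ℕ} (v : (Fin d → ℝ) → ℝ) : (Fin d → ℝ) → (Fin d → ℝ) :=
  fun x i => fderiv ℝ v x (Pi.single i 1)

/-- The divergence `div τ = Σᵢ ∂ᵢ τᵢ` of a vector field. -/
def divg {d : ℕ} (τ : (Fin d → ℝ) → (Fin d → ℝ)) : (Fin d → ℝ) → ℝ :=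
  fun x => ∑ i, fderiv ℝ (fun y => τ y i) x (Pi.single i 1)

/-- The curl of a vector field on `ℝ³`. -/
def curl (v : (Fin 3 → ℝ) → (Fin 3 → ℝ)) : (Fin 3 → ℝ) → (Fin 3 → ℝ) :=
  fun x => ![fderiv ℝ (fun y => v y 2) x (Pi.single 1 1) - fderiv ℝ (fun y => v y 1) x (Pi.single 2 1),
             fderiv ℝ (fun y => v y 0) x (Pi.single 2 1) - fderiv ℝ (fun y => v y 2) x (Pi.single 0 1),
             fderiv ℝ (fun y => v y 1) x (Pi.single 0 1) - fderiv ℝ (fun y => v y 0) x (Pi.single 1 1)]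

/-- Rotation of a vector in `ℝ²` by `-π/2`: `(z₁, z₂)^⊥ = (z₂, -z₁)`. -/
def perp (z : Fin 2 → ℝ) : Fin 2 → ℝ := ![z 1, -z 0]

open MvPolynomial in
lemma aux_coeff_euler (p : MvPolynomial (Fin 2) ℝ) (m : Fin 2 →₀ ℕ) :
    coeff m (X 0 * pderiv 0 p + X 1 * pderiv 1 p) = ((m 0 + m 1 : ℕ) : ℝ) * coeff m p := by
  induction p using MvPolynomial.induction_on' with
  | monomial s a =>
    rw [X_mul_pderiv_monomial, X_mul_pderiv_monomial]
    simp only [coeff_add, coeff_smul, coeff_monomial]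
    split_ifs with h
    · subst h; push_cast; simp; ring
    · simp
  | add p q hp hq =>
    have : X 0 * pderiv 0 (p + q) + X 1 * pderiv 1 (p + q) =
      (X 0 * pderiv 0 p + X 1 * pderiv 1 p) + (X 0 * pderiv 0 q + X 1 * pderiv 1 q) := by
      simp only [map_add]; ring
    rw [this, coeff_add, hp, hq, coeff_add]; ring

open MvPolynomial in
lemma aux_deg_le {p : MvPolynomial (Fin 2) ℝ} {n : ℕ} :
    p.totalDegree ≤ n ↔ ∀ m, coeff m p ≠ 0 → m 0 + m 1 ≤ n := by
  rw [totalDegree, Finset.sup_le_iff]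
  simp [mem_support_iff, Finsupp.sum_fintype, Fin.sum_univ_two]

open MvPolynomial in
lemma aux_deg_pderiv {p : MvPolynomial (Fin 2) ℝ} {n : ℕ} (h : p.totalDegree ≤ n + 1) (i : Fin 2) :
    (pderiv i p).totalDegree ≤ n := by
  rw [aux_deg_le] at h ⊢
  intro m hm
  rw [coeff_pderiv] at hm
  have := h _ (left_ne_zero_of_mul hm)
  fin_cases i <;> simp at this <;> omega

open MvPolynomial in
lemma aux_euler_inv (r : MvPolynomial (Fin 2) ℝ) {n : ℕ} (h : r.totalDegree ≤ n)
    (h0 : coeff 0 r = 0) : ∃ q : MvPolynomial (Fin 2) ℝ, q.totalDegree ≤ n ∧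
      X 0 * pderiv 0 q + X 1 * pderiv 1 q = r := by
  have hq : ∀ m, coeff m (∑ s ∈ r.support, monomial s (coeff s r / ((s 0 + s 1 : ℕ) : ℝ)))
      = coeff m r / ((m 0 + m 1 : ℕ) : ℝ) := by
    intro m
    rw [coeff_sum]
    simp only [coeff_monomial]
    rw [Finset.sum_ite_eq']
    split_ifs with hm
    · rfl
    · rw [notMem_support_iff.1 hm, zero_div]
  refine ⟨∑ s ∈ r.support, monomial s (coeff s r / ((s 0 + s 1 : ℕ) : ℝ)), ?_, ?_⟩
  · rw [aux_deg_le] at h ⊢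
    intro m hm
    rw [hq] at hm
    exact h m fun h' => hm (by rw [h', zero_div])
  · ext m
    rw [aux_coeff_euler, hq]
    by_cases hm : m 0 + m 1 = 0
    · have : m = 0 := by
        ext i; fin_cases i <;> simp <;> omega
      subst this; simp [h0]
    · have : ((m 0 + m 1 : ℕ) : ℝ) ≠ 0 := by exact_mod_cast hm
      field_simp

open MvPolynomial in
lemma aux_core_exists {a b : MvPolynomial (Fin 2) ℝ} {n : ℕ} (ha : a.totalDegree ≤ n)
    (hb : b.totalDegree ≤ n) : ∃ q p : MvPolynomial (Fin 2) ℝ, q.totalDegree ≤ n + 1 ∧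
      (p = 0 ∨ p.totalDegree + 1 ≤ n) ∧ a = pderiv 0 q + p * X 1 ∧ b = pderiv 1 q - p * X 0 := by
  obtain ⟨q, hq, he⟩ := aux_euler_inv (X 0 * a + X 1 * b) (n := n + 1) (by
    refine (totalDegree_add _ _).trans (max_le ?_ ?_) <;>
    · refine (totalDegree_mul _ _).trans ?_
      rw [totalDegree_X]; omega) (by
    rw [← constantCoeff_eq]; simp)
  have h1 : X 0 * (a - pderiv 0 q) = X 1 * (pderiv 1 q - b) := by linear_combination -he
  have hpr : Prime (X 1 : MvPolynomial (Fin 2) ℝ) := X_prime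
  have hnd : ¬ (X 1 : MvPolynomial (Fin 2) ℝ) ∣ X 0 := by
    rw [X_dvd_X]; simp
  obtain ⟨p, hp⟩ := (hpr.dvd_or_dvd ⟨_, h1⟩).resolve_left hnd
  have h2 : X 0 * p = pderiv 1 q - b := by
    apply mul_left_cancel₀ hpr.ne_zero
    rw [← h1, hp]; ring
  refine ⟨q, p, hq, ?_, by linear_combination hp, by rw [mul_comm, h2]; ring⟩
  by_cases h : p = 0
  · exact Or.inl h
  · right
    have h3 : (X 1 * p).totalDegree = 1 + p.totalDegree := by
      rw [totalDegree_mul_of_isDomain hpr.ne_zero h, totalDegree_X]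
    rw [add_comm, ← h3, ← hp]
    exact (totalDegree_sub _ _).trans (max_le ha (aux_deg_pderiv hq 0))

open MvPolynomial in
lemma aux_core_unique {q p : MvPolynomial (Fin 2) ℝ} (h0 : pderiv 0 q + p * X 1 = 0)
    (h1 : pderiv 1 q - p * X 0 = 0) : pderiv 0 q = 0 ∧ pderiv 1 q = 0 ∧ p = 0 := by
  have he : X 0 * pderiv 0 q + X 1 * pderiv 1 q = 0 := by
    linear_combination X 0 * h0 + X 1 * h1
  have hq : ∀ i, pderiv i q = 0 := by
    intro i
    ext m
    rw [coeff_pderiv]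
    have := aux_coeff_euler q (m + Finsupp.single i 1)
    rw [he, coeff_zero, eq_comm, mul_eq_zero] at this
    rcases this with h | h
    · exfalso
      have h := Nat.cast_eq_zero.1 h
      fin_cases i <;> simp at h
    · rw [h]; simp
  refine ⟨hq 0, hq 1, ?_⟩
  rw [hq 0, zero_add] at h0
  exact (mul_eq_zero.1 h0).resolve_right (X_ne_zero 1)

open MvPolynomial in
lemma aux_hasFDerivAt (p : MvPolynomial (Fin 2) ℝ) (x : Fin 2 → ℝ) :
    HasFDerivAt (fun y => eval y p)
      (∑ i, eval x (pderiv i p) • (ContinuousLinearMap.proj i : (Fin 2 → ℝ) →L[ℝ] ℝ)) x := by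
  induction p using MvPolynomial.induction_on with
  | C a => simpa using hasFDerivAt_const a x
  | add p q hp hq =>
    have h := hp.add hq
    rw [← Finset.sum_add_distrib] at h
    simp only [map_add, add_smul]
    exact h
  | mul_X p i hp =>
    simp only [map_mul, eval_X]
    have := hp.mul (ContinuousLinearMap.proj i : (Fin 2 → ℝ) →L[ℝ] ℝ).hasFDerivAt (x := x)
    refine this.congr_fderiv ?_
    ext v
    fin_cases i <;> simp [pderiv_X, Fin.sum_univ_two, Derivation.leibniz] <;> ring

open MvPolynomial in
lemma aux_grad (p : MvPolynomial (Fin 2) ℝ) (x c : Fin 2 → ℝ) (i : Fin 2) :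
    grad (fun y => eval (y - c) p) x i = eval (x - c) (pderiv i p) := by
  have := (aux_hasFDerivAt p (x - c)).comp x ((hasFDerivAt_id x).sub_const c)
  have h2 : fderiv ℝ (fun y => eval (y - c) p) x = _ := HasFDerivAt.fderiv this
  rw [grad, h2]
  fin_cases i <;> simp [Fin.sum_univ_two]

open MvPolynomial in
lemma aux_shift (p : MvPolynomial (Fin 2) ℝ) (c : Fin 2 → ℝ) :
    ∃ q : MvPolynomial (Fin 2) ℝ, q.totalDegree ≤ p.totalDegree ∧
      ∀ x, eval x q = eval (x + c) p := by
  refine ⟨∑ s ∈ p.support, C (coeff s p) * ∏ i, (X i + C (c i)) ^ s i, ?_, ?_⟩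
  · refine totalDegree_finsetSum_le fun s hs => ?_
    have h1 := aux_deg_le.1 (le_refl p.totalDegree) s (mem_support_iff.1 hs)
    refine (totalDegree_mul _ _).trans ?_
    rw [totalDegree_C, zero_add]
    refine (totalDegree_finsetProd _ _).trans ?_
    have h2 : ∀ i, ((X i + C (c i) : MvPolynomial (Fin 2) ℝ) ^ s i).totalDegree ≤ s i := by
      intro i
      refine (totalDegree_pow _ _).trans ?_
      have : (X i + C (c i) : MvPolynomial (Fin 2) ℝ).totalDegree ≤ 1 :=
        (totalDegree_add _ _).trans (by simp)
      nlinarith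
    rw [Fin.sum_univ_two]
    linarith [h2 0, h2 1]
  · intro x
    rw [eval_eq' (x + c)]
    simp

open MvPolynomial in
lemma aux_mem (c : Fin 2 → ℝ) (n : ℕ) (f : (Fin 2 → ℝ) → ℝ) : f ∈ polySpaceZ 2 (n : ℤ) ↔
    ∃ p : MvPolynomial (Fin 2) ℝ, p.totalDegree ≤ n ∧ f = fun x => eval (x - c) p := by
  rw [polySpaceZ, if_pos (by positivity), Int.toNat_natCast]
  constructor
  · rintro ⟨p, hp, h⟩
    obtain ⟨q, hq, hh⟩ := aux_shift p c
    exact ⟨q, hq.trans hp, funext fun x => by rw [hh, h]; simp⟩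
  · rintro ⟨p, hp, rfl⟩
    obtain ⟨q, hq, hh⟩ := aux_shift p (-c)
    exact ⟨q, hq.trans hp, fun x => by rw [hh]; simp [sub_eq_add_neg]⟩

open MvPolynomial in
lemma aux_mem' (c : Fin 2 → ℝ) (n : ℕ) (f : (Fin 2 → ℝ) → ℝ) : f ∈ polySpaceZ 2 ((n : ℤ) - 1) ↔
    ∃ p : MvPolynomial (Fin 2) ℝ, (p = 0 ∨ p.totalDegree + 1 ≤ n) ∧
      f = fun x => eval (x - c) p := by
  rcases n with _ | n
  · rw [polySpaceZ, if_neg (by simp)]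
    simp only [Submodule.mem_bot]
    constructor
    · rintro rfl
      exact ⟨0, Or.inl rfl, by funext x; simp⟩
    · rintro ⟨p, hp | hp, rfl⟩
      · subst hp; funext x; simp
      · omega
  · have : ((n + 1 : ℕ) : ℤ) - 1 = (n : ℤ) := by push_cast; ring
    rw [this, aux_mem c]
    constructor
    · rintro ⟨p, hp, h⟩
      exact ⟨p, Or.inr (by omega), h⟩
    · rintro ⟨p, hp, h⟩
      refine ⟨p, ?_, h⟩
      rcases hp with rfl | hp
      · simp
      · omega

lemma aux_perp_perp (z : Fin 2 → ℝ) : perp (perp z) = -z := by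
  ext i; fin_cases i <;> simp [perp]

lemma aux_perp_add (z w : Fin 2 → ℝ) : perp (z + w) = perp z + perp w := by
  ext i; fin_cases i <;> simp [perp]; ring

lemma aux_perp_smul (a : ℝ) (z : Fin 2 → ℝ) : perp (a • z) = a • perp z := by
  ext i; fin_cases i <;> simp [perp]

lemma aux_perp_neg (z : Fin 2 → ℝ) : perp (-z) = - perp z := by
  ext i; fin_cases i <;> simp [perp]

lemma aux_perp_mem {n : ℤ} {f : (Fin 2 → ℝ) → (Fin 2 → ℝ)} (hf : f ∈ vecPolySpaceZ 2 n) :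
    (fun x => perp (f x)) ∈ vecPolySpaceZ 2 n := by
  intro i
  fin_cases i
  · exact hf 1
  · exact (polySpaceZ 2 n).neg_mem (hf 0)

lemma aux_grad_mem {n : ℕ} {q : (Fin 2 → ℝ) → ℝ} (hq : q ∈ polySpaceZ 2 ((n : ℤ) + 1)) :
    grad q ∈ vecPolySpaceZ 2 (n : ℤ) := by
  intro i
  have hq : q ∈ polySpaceZ 2 ((n + 1 : ℕ) : ℤ) := by exact_mod_cast hq
  obtain ⟨p, hp, rfl⟩ := (aux_mem 0 _ _).1 hq
  rw [aux_mem 0]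
  exact ⟨MvPolynomial.pderiv i p, aux_deg_pderiv hp i, funext fun x => aux_grad p x 0 i⟩

open MvPolynomial in
lemma aux_mul_mem {n : ℕ} (c : Fin 2 → ℝ) {p : (Fin 2 → ℝ) → ℝ}
    (hp : p ∈ polySpaceZ 2 ((n : ℤ) - 1)) :
    (fun x => p x • (x - c)) ∈ vecPolySpaceZ 2 (n : ℤ) := by
  intro i
  obtain ⟨r, hr, rfl⟩ := (aux_mem' c _ _).1 hp
  rw [aux_mem c]
  refine ⟨r * X i, ?_, funext fun x => by simp⟩
  rcases hr with rfl | hr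
  · simp
  · refine (totalDegree_mul _ _).trans ?_
    rw [totalDegree_X]; exact hr

open MvPolynomial in
lemma aux_exists {n : ℕ} (c : Fin 2 → ℝ) {τ : (Fin 2 → ℝ) → (Fin 2 → ℝ)}
    (h : τ ∈ vecPolySpaceZ 2 (n : ℤ)) : ∃ q ∈ polySpaceZ 2 ((n : ℤ) + 1),
      ∃ p ∈ polySpaceZ 2 ((n : ℤ) - 1), ∀ x, τ x = grad q x + p x • perp (x - c) := by
  obtain ⟨a, ha, ha'⟩ := (aux_mem c _ _).1 (h 0)
  obtain ⟨b, hb, hb'⟩ := (aux_mem c _ _).1 (h 1)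
  obtain ⟨q, p, hq, hp, h1, h2⟩ := aux_core_exists ha hb
  refine ⟨fun x => eval (x - c) q, ?_, fun x => eval (x - c) p, (aux_mem' c _ _).2 ⟨p, hp, rfl⟩, ?_⟩
  · have := (aux_mem c (n + 1) _).2 ⟨q, hq, rfl⟩
    exact_mod_cast this
  · intro x
    ext i
    rw [Pi.add_apply, aux_grad]
    fin_cases i
    · refine (congrFun ha' x).trans ?_
      rw [h1]; simp [perp]
    · refine (congrFun hb' x).trans ?_
      rw [h2]; simp [perp]; ring

open MvPolynomial in
lemma aux_unique {n : ℕ} (c : Fin 2 → ℝ) {q q' p p' : (Fin 2 → ℝ) → ℝ}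
    (hq : q ∈ polySpaceZ 2 ((n : ℤ) + 1)) (hq' : q' ∈ polySpaceZ 2 ((n : ℤ) + 1))
    (hp : p ∈ polySpaceZ 2 ((n : ℤ) - 1)) (hp' : p' ∈ polySpaceZ 2 ((n : ℤ) - 1))
    (h : ∀ x, grad q x + p x • perp (x - c) = grad q' x + p' x • perp (x - c)) :
    grad q = grad q' ∧ p = p' := by
  have hq : q ∈ polySpaceZ 2 ((n + 1 : ℕ) : ℤ) := by exact_mod_cast hq
  have hq' : q' ∈ polySpaceZ 2 ((n + 1 : ℕ) : ℤ) := by exact_mod_cast hq'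
  obtain ⟨q, -, rfl⟩ := (aux_mem c _ _).1 hq
  obtain ⟨q', -, rfl⟩ := (aux_mem c _ _).1 hq'
  obtain ⟨p, -, rfl⟩ := (aux_mem' c _ _).1 hp
  obtain ⟨p', -, rfl⟩ := (aux_mem' c _ _).1 hp'
  have key := aux_core_unique (q := q - q') (p := p - p')
    (by
      apply MvPolynomial.funext
      intro x
      have := congrFun (h (x + c)) 0
      simp only [Pi.add_apply, aux_grad] at this
      simp [perp] at this ⊢
      linarith)
    (by
      apply MvPolynomial.funext
      intro x
      have := congrFun (h (x + c)) 1
      simp only [Pi.add_apply, aux_grad] at this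
      simp [perp] at this ⊢
      linarith)
  obtain ⟨k0, k1, k2⟩ := key
  rw [map_sub, sub_eq_zero] at k0 k1
  rw [sub_eq_zero] at k2
  refine ⟨?_, by rw [k2]⟩
  funext x i
  rw [aux_grad, aux_grad]
  fin_cases i
  · exact congrArg _ k0
  · exact congrArg _ k1

/-- Two direct sum decompositions of `(𝒫ⁿ)²` in `ℝ²`:
`(𝒫ⁿ)² = ∇(𝒫^{n+1}) ⊕ {x ↦ p x • (x - c)^⊥}` and
`(𝒫ⁿ)² = (∇(𝒫^{n+1}))^⊥ ⊕ {x ↦ p x • (x - c)}`. -/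
theorem statement2 (n : ℕ) (c : Fin 2 → ℝ) :
    let G : Set ((Fin 2 → ℝ) → (Fin 2 → ℝ)) :=
      {f | ∃ p ∈ polySpaceZ 2 ((n : ℤ) + 1), f = grad p}
    let Gc : Set ((Fin 2 → ℝ) → (Fin 2 → ℝ)) :=
      {f | ∃ p ∈ polySpaceZ 2 ((n : ℤ) - 1), f = fun x => p x • perp (x - c)}
    let C : Set ((Fin 2 → ℝ) → (Fin 2 → ℝ)) :=
      {f | ∃ z ∈ polySpaceZ 2 ((n : ℤ) + 1), f = fun x => perp (grad z x)}
    let Cc : Set ((Fin 2 → ℝ) → (Fin 2 → ℝ)) :=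
      {f | ∃ p ∈ polySpaceZ 2 ((n : ℤ) - 1), f = fun x => p x • (x - c)}
    (G ⊆ (vecPolySpaceZ 2 (n : ℤ) : Set _) ∧
     Gc ⊆ (vecPolySpaceZ 2 (n : ℤ) : Set _) ∧
     ∀ τ ∈ vecPolySpaceZ 2 (n : ℤ), ∃ g ∈ G, ∃ h ∈ Gc,
       τ = g + h ∧ ∀ g' ∈ G, ∀ h' ∈ Gc, τ = g' + h' → g' = g ∧ h' = h) ∧
    (C ⊆ (vecPolySpaceZ 2 (n : ℤ) : Set _) ∧
     Cc ⊆ (vecPolySpaceZ 2 (n : ℤ) : Set _) ∧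
     ∀ τ ∈ vecPolySpaceZ 2 (n : ℤ), ∃ g ∈ C, ∃ h ∈ Cc,
       τ = g + h ∧ ∀ g' ∈ C, ∀ h' ∈ Cc, τ = g' + h' → g' = g ∧ h' = h) := by
  intro G Gc C Cc
  have hgneg : ∀ z : (Fin 2 → ℝ) → ℝ, ∀ x, grad (-z) x = - grad z x := by
    intro z x; ext i; simp [grad, fderiv_neg]
  have hC : C ⊆ (vecPolySpaceZ 2 (n : ℤ) : Set _) := by
    rintro f ⟨q, hq, rfl⟩
    exact aux_perp_mem (aux_grad_mem hq)
  have hGc : Gc ⊆ (vecPolySpaceZ 2 (n : ℤ) : Set _) := by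
    rintro f ⟨p, hp, rfl⟩
    have := aux_perp_mem (aux_mul_mem c hp)
    simp only [aux_perp_smul] at this
    exact this
  refine ⟨⟨?_, hGc, ?_⟩, hC, ?_, ?_⟩
  · rintro f ⟨q, hq, rfl⟩
    exact aux_grad_mem hq
  · intro τ hτ
    obtain ⟨q, hq, p, hp, h⟩ := aux_exists c hτ
    refine ⟨_, ⟨q, hq, rfl⟩, _, ⟨p, hp, rfl⟩, funext h, ?_⟩
    rintro _ ⟨q', hq', rfl⟩ _ ⟨p', hp', rfl⟩ h'
    obtain ⟨h1, h2⟩ := aux_unique c hq' hq hp' hp (fun x => by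
      rw [← h x, h']; rfl)
    exact ⟨h1, by rw [h2]⟩
  · rintro f ⟨p, hp, rfl⟩
    exact aux_mul_mem c hp
  · intro τ hτ
    obtain ⟨q, hq, p, hp, h⟩ := aux_exists c (aux_perp_mem hτ)
    refine ⟨_, ⟨-q, Submodule.neg_mem _ hq, rfl⟩, _, ⟨p, hp, rfl⟩, ?_, ?_⟩
    · funext x
      have := congrArg perp (h x)
      rw [aux_perp_perp, aux_perp_add, aux_perp_smul, aux_perp_perp] at this
      rw [Pi.add_apply, hgneg, aux_perp_neg, ← neg_neg (τ x), this, neg_add, smul_neg, neg_neg]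
    · rintro _ ⟨q', hq', rfl⟩ _ ⟨p', hp', rfl⟩ h'
      obtain ⟨h1, h2⟩ := aux_unique c (Submodule.neg_mem _ hq') hq hp' hp (fun x => by
        rw [← h x, h', hgneg, Pi.add_apply, aux_perp_add, aux_perp_perp, aux_perp_smul])
      refine ⟨?_, by rw [h2]⟩
      funext x
      rw [hgneg, ← h1, hgneg, neg_neg]

end
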